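/- arXiv:1205.6350 — 2 statements merged into one kernel-verified Lean document; each statement's English description precedes it below -/
import Mathlib

section
/- (Curves of constant curvature on the paraboloid are planar.) Let φ : J → ℝ be smooth on an open interval J with φ̇² + φ² > 0 on J, and suppose there is a constant a ≠ 0 with (φφ̈ − 2φ̇² − φ²)/(φ̇² + φ²)^{3/2} = a for all v ∈ J. Define the curve z̄ : J → ℝ⁴₁ by z̄(v) = φ(v)cos v · e₁ + φ(v)sin v · e₂ + (φ(v)²/2) · ξ₁ + ξ₂. Then z̄ is a plane curve: there exists a two-dimensional affine subspace of ℝ⁴ containing the image z̄(J). -/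
namespace MeridianParabolic

noncomputable section

/-- The Minkowski inner product of signature (3,1) on `ℝ⁴`:
`⟨x,y⟩ = x₁y₁ + x₂y₂ + x₃y₃ − x₄y₄`. -/
def mink (x y : Fin 4 → ℝ) : ℝ := x 0 * y 0 + x 1 * y 1 + x 2 * y 2 - x 3 * y 3

/-- The first standard basis vector `e₁`. -/
def e1 : Fin 4 → ℝ := ![1, 0, 0, 0]

/-- The second standard basis vector `e₂`. -/
def e2 : Fin 4 → ℝ := ![0, 1, 0, 0]

/-- The lightlike vector `ξ₁ = (e₃ + e₄)/√2`. -/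
def xi1 : Fin 4 → ℝ := ![0, 0, 1 / Real.sqrt 2, 1 / Real.sqrt 2]

/-- The lightlike vector `ξ₂ = (−e₃ + e₄)/√2`. -/
def xi2 : Fin 4 → ℝ := ![0, 0, -(1 / Real.sqrt 2), 1 / Real.sqrt 2]

/-- The curvature `κ_m(u) = (f'g'' − g'f'')/(−2f'g')^{3/2}` of the meridians. -/
def kappam (f g : ℝ → ℝ) (u : ℝ) : ℝ :=
  (deriv f u * deriv (deriv g) u - deriv g u * deriv (deriv f) u) /
    (-2 * deriv f u * deriv g u) ^ ((3 : ℝ) / 2)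

/-- The curvature `κ̄(v) = (φφ̈ − 2φ̇² − φ²)/(φ̇² + φ²)^{3/2}`. -/
def kappabar (φ : ℝ → ℝ) (v : ℝ) : ℝ :=
  (φ v * deriv (deriv φ) v - 2 * (deriv φ v) ^ 2 - (φ v) ^ 2) /
    ((deriv φ v) ^ 2 + (φ v) ^ 2) ^ ((3 : ℝ) / 2)

/-- The curve `z̄(v) = φ cos v · e₁ + φ sin v · e₂ + (φ²/2) ξ₁ + ξ₂` on the
paraboloid `𝒫²`. -/
def zbar (φ : ℝ → ℝ) (v : ℝ) : Fin 4 → ℝ :=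
  (φ v * Real.cos v) • e1 + (φ v * Real.sin v) • e2 + ((φ v) ^ 2 / 2) • xi1 + xi2

open Real

/-- The power `x ^ (3 / 2)` is the cube of the square root. -/
lemma rpow_three_halves {x : ℝ} (hx : 0 ≤ x) : x ^ ((3 : ℝ) / 2) = √x ^ 3 := by
  rw [sqrt_eq_rpow, ← rpow_natCast, ← rpow_mul hx]
  norm_num

/-- The velocity `(ẋ, ẏ)` of the planar curve `φ (cos v, sin v)` and its speed `σ` satisfy
`(ẏ / σ)˙ = -κ̄ ẋ`. -/
lemma hasDerivAt_unitTangent_snd {φ : ℝ → ℝ} {v : ℝ}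
    (h0 : HasDerivAt φ (deriv φ v) v) (h1 : HasDerivAt (deriv φ) (deriv (deriv φ) v) v)
    (hpos : 0 < deriv φ v ^ 2 + φ v ^ 2) :
    HasDerivAt (fun u => (deriv φ u * sin u + φ u * cos u) / √(deriv φ u ^ 2 + φ u ^ 2))
      (-(kappabar φ v * (deriv φ v * cos v - φ v * sin v))) v := by
  have hs := Real.sqrt_pos.2 hpos
  have hsq := Real.sq_sqrt hpos.le
  have hσ := ((h1.fun_pow 2).fun_add (h0.fun_pow 2)).sqrt hpos.ne'
  have hnum := (h1.fun_mul (hasDerivAt_sin v)).fun_add (h0.fun_mul (hasDerivAt_cos v))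
  refine (hnum.fun_div hσ hs.ne').congr_deriv ?_
  rw [kappabar, rpow_three_halves hpos.le]
  generalize √(deriv φ v ^ 2 + φ v ^ 2) = s at *
  field_simp
  rw [hsq]
  push_cast
  ring

/-- The velocity `(ẋ, ẏ)` of the planar curve `φ (cos v, sin v)` and its speed `σ` satisfy
`(ẋ / σ)˙ = κ̄ ẏ`. -/
lemma hasDerivAt_unitTangent_fst {φ : ℝ → ℝ} {v : ℝ}
    (h0 : HasDerivAt φ (deriv φ v) v) (h1 : HasDerivAt (deriv φ) (deriv (deriv φ) v) v)
    (hpos : 0 < deriv φ v ^ 2 + φ v ^ 2) :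
    HasDerivAt (fun u => (deriv φ u * cos u - φ u * sin u) / √(deriv φ u ^ 2 + φ u ^ 2))
      (kappabar φ v * (deriv φ v * sin v + φ v * cos v)) v := by
  have hs := Real.sqrt_pos.2 hpos
  have hsq := Real.sq_sqrt hpos.le
  have hσ := ((h1.fun_pow 2).fun_add (h0.fun_pow 2)).sqrt hpos.ne'
  have hnum := (h1.fun_mul (hasDerivAt_cos v)).fun_sub (h0.fun_mul (hasDerivAt_sin v))
  refine (hnum.fun_div hσ hs.ne').congr_deriv ?_
  rw [kappabar, rpow_three_halves hpos.le]
  generalize √(deriv φ v ^ 2 + φ v ^ 2) = s at *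
  field_simp
  rw [hsq]
  push_cast
  ring

/-- A function with vanishing derivative on an open preconnected set is constant there. -/
lemma exists_eq_const_of_hasDerivAt_zero {J : Set ℝ} (hJo : IsOpen J) (hJc : IsPreconnected J)
    {f : ℝ → ℝ} (hf : ∀ v ∈ J, HasDerivAt f 0 v) : ∃ c, ∀ v ∈ J, f v = c :=
  hJo.exists_is_const_of_deriv_eq_zero hJc
    (fun v hv => (hf v hv).differentiableAt.differentiableWithinAt) fun v hv => (hf v hv).deriv

/-- If `κ̄` is a nonzero constant `a` then `φ (cos v, sin v)` lies on a circle of radius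
`1 / |a|`. -/
lemma exists_circle_of_kappabar_eq {J : Set ℝ} (hJo : IsOpen J) (hJc : IsPreconnected J)
    {φ : ℝ → ℝ} (hφ : ContDiffOn ℝ 2 φ J)
    (hpos : ∀ v ∈ J, 0 < deriv φ v ^ 2 + φ v ^ 2)
    {a : ℝ} (ha : a ≠ 0) (hκ : ∀ v ∈ J, kappabar φ v = a) :
    ∃ c₁ c₂ : ℝ, ∀ v ∈ J,
      (φ v * cos v - c₁) ^ 2 + (φ v * sin v - c₂) ^ 2 = 1 / a ^ 2 := by
  have h0 : ∀ v ∈ J, HasDerivAt φ (deriv φ v) v := fun v hv =>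
    ((hφ.differentiableOn two_ne_zero).differentiableAt (hJo.mem_nhds hv)).hasDerivAt
  have hφ' : ContDiffOn ℝ 1 (deriv φ) J := hφ.deriv_of_isOpen hJo one_add_one_eq_two.le
  have h1 : ∀ v ∈ J, HasDerivAt (deriv φ) (deriv (deriv φ) v) v := fun v hv =>
    ((hφ'.differentiableOn one_ne_zero).differentiableAt (hJo.mem_nhds hv)).hasDerivAt
  obtain ⟨c₁, hc₁⟩ := exists_eq_const_of_hasDerivAt_zero hJo hJc
    (f := fun u => φ u * cos u +
      (deriv φ u * sin u + φ u * cos u) / √(deriv φ u ^ 2 + φ u ^ 2) / a) fun v hv => by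
    refine (((h0 v hv).fun_mul (hasDerivAt_cos v)).fun_add
      ((hasDerivAt_unitTangent_snd (h0 v hv) (h1 v hv) (hpos v hv)).div_const a)).congr_deriv ?_
    rw [hκ v hv]
    field_simp
    ring
  obtain ⟨c₂, hc₂⟩ := exists_eq_const_of_hasDerivAt_zero hJo hJc
    (f := fun u => φ u * sin u -
      (deriv φ u * cos u - φ u * sin u) / √(deriv φ u ^ 2 + φ u ^ 2) / a) fun v hv => by
    refine (((h0 v hv).fun_mul (hasDerivAt_sin v)).fun_sub
      ((hasDerivAt_unitTangent_fst (h0 v hv) (h1 v hv) (hpos v hv)).div_const a)).congr_deriv ?_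
    rw [hκ v hv]
    field_simp
    ring
  refine ⟨c₁, c₂, fun v hv => ?_⟩
  rw [← hc₁ v hv, ← hc₂ v hv]
  have hs := Real.sqrt_pos.2 (hpos v hv)
  have hsq := Real.sq_sqrt (hpos v hv).le
  generalize √(deriv φ v ^ 2 + φ v ^ 2) = s at *
  field_simp
  linear_combination (deriv φ v ^ 2 + φ v ^ 2) * sin_sq_add_cos_sq v - hsq

/-- curves of constant curvature on the paraboloid are planar: if the
curvature `κ̄ = (φφ̈ − 2φ̇² − φ²)/(φ̇² + φ²)^{3/2}` of the curve `z̄` on the paraboloid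
`𝒫²` is a nonzero constant `a`, then `z̄` is a plane curve: its image is contained in a
two-dimensional affine subspace of `ℝ⁴`. -/
theorem statement13
    (J : Set ℝ) (hJopen : IsOpen J) (hJconn : IsPreconnected J)
    (φ : ℝ → ℝ) (hφ : ContDiffOn ℝ (⊤ : ℕ∞) φ J)
    (hφpos : ∀ v ∈ J, 0 < (deriv φ v) ^ 2 + (φ v) ^ 2)
    (a : ℝ) (ha : a ≠ 0)
    (hκ : ∀ v ∈ J, kappabar φ v = a) :
    ∃ p d1 d2 : Fin 4 → ℝ, LinearIndependent ℝ ![d1, d2] ∧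
      ∀ v ∈ J, ∃ s t : ℝ, zbar φ v = p + s • d1 + t • d2 := by
  obtain ⟨c₁, c₂, hc⟩ := exists_circle_of_kappabar_eq hJopen hJconn
    (hφ.of_le (WithTop.coe_le_coe.2 (le_top : (2 : ℕ∞) ≤ ⊤))) hφpos ha hκ
  refine ⟨((1 / a ^ 2 - c₁ ^ 2 - c₂ ^ 2) / 2) • xi1 + xi2, e1 + c₁ • xi1, e2 + c₂ • xi1, ?_,
    fun v hv => ⟨φ v * cos v, φ v * sin v, ?_⟩⟩
  · rw [LinearIndependent.pair_iff]
    intro s t h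
    exact ⟨by simpa [e1, e2, xi1] using congrFun h 0, by simpa [e1, e2, xi1] using congrFun h 1⟩
  · have h : φ v ^ 2 / 2 = (1 / a ^ 2 - c₁ ^ 2 - c₂ ^ 2) / 2 + φ v * cos v * c₁ +
        φ v * sin v * c₂ := by
      linear_combination hc v hv / 2 - φ v ^ 2 / 2 * sin_sq_add_cos_sq v
    rw [zbar, h]
    module

end
end MeridianParabolic
end

section
/- Let A, B, C be real constants with A² + B² − 2C > 0, set θ(v) = A cos v + B sin v, let ε ∈ {1,−1}, and let J be an open interval on which θ(v)² − 2C > 0. Define φ(v) = −θ(v) + ε√(θ(v)² − 2C). Then for all v ∈ J: φ̇(v)² + φ(v)² = (A² + B² − 2C)·(θ(v) − ε√(θ(v)² − 2C))² / (θ(v)² − 2C). -/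
namespace MeridianParabolic

noncomputable section

/-- Derivative of `-f + ε √(f² - c)` at a point where the radicand does not vanish. -/
lemma hasDerivAt_neg_add_mul_sqrt {f : ℝ → ℝ} {f' x : ℝ} (c ε : ℝ) (hf : HasDerivAt f f' x)
    (hx : f x ^ 2 - c ≠ 0) :
    HasDerivAt (fun u => -f u + ε * Real.sqrt (f u ^ 2 - c))
      (-f' + ε * (f x * f' / Real.sqrt (f x ^ 2 - c))) x := by
  have h : HasDerivAt (fun u => f u ^ 2 - c) (2 * f x * f') x := by
    simpa using (hf.pow 2).sub_const c
  refine (hf.neg.add ((h.sqrt hx).const_mul ε)).congr_deriv ?_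
  rw [mul_assoc, mul_div_mul_left _ _ two_ne_zero]

/-- Derivative of `A cos + B sin`. -/
lemma hasDerivAt_cos_add_sin (A B v : ℝ) :
    HasDerivAt (fun u => A * Real.cos u + B * Real.sin u)
      (-A * Real.sin v + B * Real.cos v) v := by
  refine (((Real.hasDerivAt_cos v).const_mul A).add
    ((Real.hasDerivAt_sin v).const_mul B)).congr_deriv ?_
  ring

/-- for constants `A, B, C` with `A² + B² − 2C > 0`,
`θ(v) = A cos v + B sin v`, `ε = ±1`, and `φ = −θ + ε√(θ² − 2C)` on an open interval `J`
where `θ² − 2C > 0`, one has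
`φ̇² + φ² = (A² + B² − 2C)(θ − ε√(θ² − 2C))²/(θ² − 2C)` on `J`. -/
theorem statement17
    (A B C : ℝ) (hABC : 0 < A ^ 2 + B ^ 2 - 2 * C)
    (ε : ℝ) (hε : ε = 1 ∨ ε = -1)
    (J : Set ℝ) (hJopen : IsOpen J) (hJconn : IsPreconnected J)
    (hθ : ∀ v ∈ J, 0 < (A * Real.cos v + B * Real.sin v) ^ 2 - 2 * C)
    (φ : ℝ → ℝ)
    (hφdef : ∀ v : ℝ, φ v = -(A * Real.cos v + B * Real.sin v) +
      ε * Real.sqrt ((A * Real.cos v + B * Real.sin v) ^ 2 - 2 * C)) :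
    ∀ v ∈ J,
      (deriv φ v) ^ 2 + (φ v) ^ 2 =
        (A ^ 2 + B ^ 2 - 2 * C) *
            ((A * Real.cos v + B * Real.sin v) -
              ε * Real.sqrt ((A * Real.cos v + B * Real.sin v) ^ 2 - 2 * C)) ^ 2 /
          ((A * Real.cos v + B * Real.sin v) ^ 2 - 2 * C) := by
  intro v hv
  have hpos := hθ v hv
  have hderiv := (hasDerivAt_neg_add_mul_sqrt (2 * C) ε
    (hasDerivAt_cos_add_sin A B v) hpos.ne').deriv
  rw [← funext hφdef] at hderiv
  rw [hderiv, hφdef v]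
  have hamp : (-A * Real.sin v + B * Real.cos v) ^ 2 +
      (A * Real.cos v + B * Real.sin v) ^ 2 = A ^ 2 + B ^ 2 := by
    linear_combination (A ^ 2 + B ^ 2) * Real.sin_sq_add_cos_sq v
  have hs := Real.sq_sqrt hpos.le
  have hs0 := (Real.sqrt_pos.mpr hpos).ne'
  have hε2 : ε ^ 2 = 1 := by rcases hε with rfl | rfl <;> norm_num
  rw [← hamp]
  generalize A * Real.cos v + B * Real.sin v = t at *
  generalize -A * Real.sin v + B * Real.cos v = d at *
  generalize Real.sqrt (t ^ 2 - 2 * C) = s at *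
  have hd : -d + ε * (t * d / s) = ε * d * (t - ε * s) / s := by
    field_simp
    linear_combination d * s * hε2
  rw [hd, add_sub_assoc, ← hs]
  field_simp
  linear_combination (t - ε * s) ^ 2 * d ^ 2 * hε2

end
end MeridianParabolic
end
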